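/- arXiv:2108.13986 — 3 statements merged into one kernel-verified Lean document; each statement's English description precedes it below -/
import Mathlib

section
/- Let K^• : 0 → K^0 → K^1 → ⋯ → K^p → 0 be a bounded cochain complex of graded R-modules such that each K^i has a Hilbert function over A, and let B be an A-algebra. Then the cohomology modules H^i(K^• ⊗_A B) have Hilbert functions over B for all 0 ≤ i ≤ p if and only if the cokernel modules C^i(K^•) ⊗_A B have Hilbert functions over B for all 0 ≤ i ≤ p. -/
open TensorProduct

/-- An `A`-module `M` is finitely generated, locally free, of constant rank `n` on
`Spec A`. -/
def IsLocallyFreeOfRank (A : Type) [CommRing A] (M : Type) [AddCommGroup M]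
    [Module A M] (n : ℕ) : Prop :=
  Module.Finite A M ∧ Module.Projective A M ∧
    ∀ (p : Ideal A) [p.IsPrime],
      Module.finrank (Localization p.primeCompl) (LocalizedModule p.primeCompl M) = n

/-- The coboundaries (in degree `ν`) of a cochain complex `K` of graded modules,
given degreewise: `B^0 = 0` and `B^{i+1} = im(d^i)`. -/
def coboundaries (A : Type) [CommRing A] (K : ℕ → ℤ → Type)
    [∀ i ν, AddCommGroup (K i ν)] [∀ i ν, Module A (K i ν)]
    (d : ∀ i ν, K i ν →ₗ[A] K (i + 1) ν) :
    ∀ (i : ℕ) (ν : ℤ), Submodule A (K i ν)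
  | 0, _ => ⊥
  | (j + 1), ν => LinearMap.range (d j ν)

/-- The coboundaries of the base change to `B` of a cochain complex `K` of graded
modules, given degreewise. -/
noncomputable def coboundariesBC (A : Type) [CommRing A] (B : Type) [CommRing B]
    [Algebra A B] (K : ℕ → ℤ → Type)
    [∀ i ν, AddCommGroup (K i ν)] [∀ i ν, Module A (K i ν)]
    (d : ∀ i ν, K i ν →ₗ[A] K (i + 1) ν) :
    ∀ (i : ℕ) (ν : ℤ), Submodule B (B ⊗[A] K i ν)
  | 0, _ => ⊥
  | (j + 1), ν => LinearMap.range (LinearMap.baseChange B (d j ν))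

/-- The degree-`ν` component of the `i`-th cohomology of the base change to `B` of a
cochain complex `K` of graded modules: `H^i(K^• ⊗_A B)_ν = Z^i_ν / B^i_ν`, realized as
the image of the cycles `Z^i_ν` in the quotient by the boundaries `B^i_ν`. -/
noncomputable abbrev cohomologyBC (A : Type) [CommRing A] (B : Type) [CommRing B]
    [Algebra A B] (K : ℕ → ℤ → Type)
    [∀ i ν, AddCommGroup (K i ν)] [∀ i ν, Module A (K i ν)]
    (d : ∀ i ν, K i ν →ₗ[A] K (i + 1) ν) (i : ℕ) (ν : ℤ) : Type :=
  ↥((LinearMap.ker (LinearMap.baseChange B (d i ν))).map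
      (coboundariesBC A B K d i ν).mkQ)

theorem islf_iff {B M : Type} [CommRing B] [AddCommGroup M] [Module B M] (n : ℕ) :
    IsLocallyFreeOfRank B M n ↔ Module.Finite B M ∧ Module.Projective B M ∧
      ∀ q : PrimeSpectrum B, Module.rankAtStalk (R := B) M q = n :=
  ⟨fun h => ⟨h.1, h.2.1, fun q => h.2.2 q.asIdeal⟩,
    fun h => ⟨h.1, h.2.1, fun q hq => h.2.2 ⟨q, hq⟩⟩⟩

theorem islf_equiv {B M N : Type} [CommRing B] [AddCommGroup M] [Module B M]
    [AddCommGroup N] [Module B N] (e : M ≃ₗ[B] N)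
    (h : ∃ n, IsLocallyFreeOfRank B M n) : ∃ n, IsLocallyFreeOfRank B N n := by
  obtain ⟨n, h⟩ := h
  obtain ⟨h1, h2, h3⟩ := (islf_iff n).1 h
  refine ⟨n, (islf_iff n).2 ⟨Module.Finite.equiv e, Module.Projective.of_equiv e, ?_⟩⟩
  intro q
  rw [← Module.rankAtStalk_eq_of_equiv e, h3]

theorem islf_prod {B M N : Type} [CommRing B] [AddCommGroup M] [Module B M]
    [AddCommGroup N] [Module B N]
    (hM : ∃ n, IsLocallyFreeOfRank B M n) (hN : ∃ n, IsLocallyFreeOfRank B N n) :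
    ∃ n, IsLocallyFreeOfRank B (M × N) n := by
  obtain ⟨m, h⟩ := hM
  obtain ⟨h1, h2, h3⟩ := (islf_iff m).1 h
  obtain ⟨n, h'⟩ := hN
  obtain ⟨h4, h5, h6⟩ := (islf_iff n).1 h'
  refine ⟨m + n, (islf_iff _).2 ⟨inferInstance, inferInstance, ?_⟩⟩
  intro q
  rw [Module.rankAtStalk_prod, Pi.add_apply, h3, h6]

theorem islf_of_prod {B M N : Type} [CommRing B] [AddCommGroup M] [Module B M]
    [AddCommGroup N] [Module B N]
    (hMN : ∃ n, IsLocallyFreeOfRank B (M × N) n) (hN : ∃ n, IsLocallyFreeOfRank B N n) :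
    ∃ n, IsLocallyFreeOfRank B M n := by
  obtain ⟨m, h⟩ := hMN
  obtain ⟨h1, h2, h3⟩ := (islf_iff m).1 h
  obtain ⟨n, h'⟩ := hN
  obtain ⟨h4, h5, h6⟩ := (islf_iff n).1 h'
  have hf : Module.Finite B M :=
    Module.Finite.of_surjective (LinearMap.fst B M N) LinearMap.fst_surjective
  have hp : Module.Projective B M :=
    Module.Projective.of_split (LinearMap.inl B M N) (LinearMap.fst B M N)
      (by ext x; simp)
  refine ⟨m - n, (islf_iff _).2 ⟨hf, hp, ?_⟩⟩
  intro q
  have := h3 q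
  rw [Module.rankAtStalk_prod, Pi.add_apply, h6] at this
  omega

theorem exists_split {B M N : Type} [CommRing B] [AddCommGroup M] [Module B M]
    [AddCommGroup N] [Module B N] (f : M →ₗ[B] N) (hf : Function.Surjective f)
    (hN : ∃ n, IsLocallyFreeOfRank B N n) :
    Nonempty (M ≃ₗ[B] LinearMap.ker f × N) := by
  obtain ⟨n, -, hp, -⟩ := hN
  obtain ⟨g, hg⟩ := Module.projective_lifting_property f LinearMap.id hf
  have hg' : ∀ y, f (g y) = y := fun y => LinearMap.congr_fun hg y
  refine ⟨LinearEquiv.symm (LinearEquiv.ofBijective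
    ((LinearMap.ker f).subtype.coprod g) ⟨?_, ?_⟩)⟩
  · rw [← LinearMap.ker_eq_bot, LinearMap.ker_eq_bot']
    rintro ⟨⟨x, hx⟩, y⟩ h
    simp only [LinearMap.coprod_apply, Submodule.subtype_apply] at h
    have h2 := congrArg f h
    rw [map_add, hg', LinearMap.mem_ker.1 hx, zero_add, map_zero] at h2
    subst h2
    rw [map_zero, add_zero] at h
    subst h
    rfl
  · intro x
    refine ⟨(⟨x - g (f x), ?_⟩, f x), ?_⟩
    · rw [LinearMap.mem_ker, map_sub, hg', sub_self]
    · simp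

theorem islf_mid {B M N : Type} [CommRing B] [AddCommGroup M] [Module B M]
    [AddCommGroup N] [Module B N] (f : M →ₗ[B] N) (hf : Function.Surjective f)
    (hN : ∃ n, IsLocallyFreeOfRank B N n)
    (hk : ∃ n, IsLocallyFreeOfRank B (LinearMap.ker f) n) :
    ∃ n, IsLocallyFreeOfRank B M n := by
  obtain ⟨e⟩ := exists_split f hf hN
  exact islf_equiv e.symm (islf_prod hk hN)

theorem islf_ker {B M N : Type} [CommRing B] [AddCommGroup M] [Module B M]
    [AddCommGroup N] [Module B N] (f : M →ₗ[B] N) (hf : Function.Surjective f)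
    (hN : ∃ n, IsLocallyFreeOfRank B N n)
    (hM : ∃ n, IsLocallyFreeOfRank B M n) :
    ∃ n, IsLocallyFreeOfRank B (LinearMap.ker f) n := by
  obtain ⟨e⟩ := exists_split f hf hN
  exact islf_of_prod (islf_equiv e hM) hN

theorem islf_baseChange {A B M : Type} [CommRing A] [CommRing B] [Algebra A B]
    [AddCommGroup M] [Module A M] (hM : ∃ n, IsLocallyFreeOfRank A M n) :
    ∃ n, IsLocallyFreeOfRank B (B ⊗[A] M) n := by
  obtain ⟨m, h⟩ := hM
  obtain ⟨h1, h2, h3⟩ := (islf_iff m).1 h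
  refine ⟨m, (islf_iff _).2 ⟨inferInstance, inferInstance, ?_⟩⟩
  intro q
  rw [Module.rankAtStalk_baseChange, h3]

theorem islf_subsingleton {B M : Type} [CommRing B] [AddCommGroup M] [Module B M]
    [Subsingleton M] : ∃ n, IsLocallyFreeOfRank B M n := by
  refine ⟨0, (islf_iff _).2 ⟨inferInstance, inferInstance, ?_⟩⟩
  intro q
  rw [Module.rankAtStalk_eq_zero_of_subsingleton, Pi.zero_apply]

theorem quotBC_equiv (A : Type) [CommRing A] (B : Type) [CommRing B]
    [Algebra A B] (K : ℕ → ℤ → Type)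
    [∀ i ν, AddCommGroup (K i ν)] [∀ i ν, Module A (K i ν)]
    (d : ∀ i ν, K i ν →ₗ[A] K (i + 1) ν) (i : ℕ) (ν : ℤ) :
    Nonempty (((B ⊗[A] K i ν) ⧸ coboundariesBC A B K d i ν) ≃ₗ[B]
      B ⊗[A] (K i ν ⧸ coboundaries A K d i ν)) := by
  have hs : Function.Surjective
      (LinearMap.baseChange B (coboundaries A K d i ν).mkQ) :=
    LinearMap.lTensor_surjective B (Submodule.mkQ_surjective _)
  have hk : coboundariesBC A B K d i ν =
      LinearMap.ker (LinearMap.baseChange B (coboundaries A K d i ν).mkQ) := by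
    cases i with
    | zero =>
      have hinj : Function.Exact (0 : K 0 ν →ₗ[A] K 0 ν) (coboundaries A K d 0 ν).mkQ := by
        rw [LinearMap.exact_iff, Submodule.ker_mkQ, LinearMap.range_zero]
        rfl
      have hex := lTensor_exact B hinj (Submodule.mkQ_surjective _)
      symm
      change _ = ⊥
      rw [LinearMap.ker_eq_bot']
      intro x hx
      obtain ⟨y, hy⟩ := (hex x).1 hx
      rw [← hy, LinearMap.lTensor_zero, LinearMap.zero_apply]
    | succ j =>
      have hinj : Function.Exact (d j ν) (coboundaries A K d (j + 1) ν).mkQ := by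
        rw [LinearMap.exact_iff, Submodule.ker_mkQ]
        rfl
      have hex := lTensor_exact B hinj (Submodule.mkQ_surjective _)
      ext x
      exact (hex x).symm
  exact ⟨(Submodule.quotEquivOfEq _ _ hk).trans
    (LinearMap.quotKerEquivOfSurjective _ hs)⟩

theorem islf_abs {B L N : Type} [CommRing B] [AddCommGroup L] [Module B L]
    [AddCommGroup N] [Module B N] (q : Submodule B L) (f : L →ₗ[B] N)
    (hle : q ≤ LinearMap.ker f) (hN : ∃ n, IsLocallyFreeOfRank B N n)
    (hC : ∃ n, IsLocallyFreeOfRank B (N ⧸ LinearMap.range f) n) :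
    (∃ n, IsLocallyFreeOfRank B ((LinearMap.ker f).map q.mkQ) n) ↔
      ∃ n, IsLocallyFreeOfRank B (L ⧸ q) n := by
  have hI0 := islf_ker (LinearMap.range f).mkQ (Submodule.mkQ_surjective _) hC hN
  have hr : LinearMap.ker (LinearMap.range f).mkQ = LinearMap.range (q.liftQ f hle) := by
    rw [Submodule.ker_mkQ, Submodule.range_liftQ]
  have hk : LinearMap.ker (q.liftQ f hle).rangeRestrict = (LinearMap.ker f).map q.mkQ := by
    rw [LinearMap.ker_rangeRestrict, Submodule.ker_liftQ]
  generalize q.liftQ f hle = g at hr hk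
  rw [hr] at hI0
  rw [← hk]
  exact ⟨islf_mid g.rangeRestrict g.surjective_rangeRestrict hI0,
    islf_ker g.rangeRestrict g.surjective_rangeRestrict hI0⟩

/-- One step: if the next cokernel is fine, then `H^i` is fine iff `C^i` is. -/
theorem islf_step (A : Type) [CommRing A] (B : Type) [CommRing B]
    [Algebra A B] (K : ℕ → ℤ → Type)
    [∀ i ν, AddCommGroup (K i ν)] [∀ i ν, Module A (K i ν)]
    (d : ∀ i ν, K i ν →ₗ[A] K (i + 1) ν)
    (hcplx : ∀ i ν, (d (i + 1) ν).comp (d i ν) = 0)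
    (hHF : ∀ i ν, ∃ n, IsLocallyFreeOfRank A (K i ν) n) (i : ℕ) (ν : ℤ)
    (hnext : ∃ n, IsLocallyFreeOfRank B
      (B ⊗[A] (K (i + 1) ν ⧸ coboundaries A K d (i + 1) ν)) n) :
    (∃ n, IsLocallyFreeOfRank B (cohomologyBC A B K d i ν) n) ↔
      ∃ n, IsLocallyFreeOfRank B (B ⊗[A] (K i ν ⧸ coboundaries A K d i ν)) n := by
  obtain ⟨e⟩ := quotBC_equiv A B K d i ν
  obtain ⟨e'⟩ := quotBC_equiv A B K d (i + 1) ν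
  have hle : coboundariesBC A B K d i ν ≤
      LinearMap.ker (LinearMap.baseChange B (d i ν)) := by
    cases i with
    | zero => exact bot_le
    | succ j =>
      change LinearMap.range (LinearMap.baseChange B (d j ν)) ≤ _
      rw [LinearMap.range_le_ker_iff, ← LinearMap.baseChange_comp, hcplx,
        LinearMap.baseChange_zero]
  exact (islf_abs _ (LinearMap.baseChange B (d i ν)) hle (islf_baseChange (hHF _ _))
    (islf_equiv e'.symm hnext)).trans ⟨islf_equiv e, islf_equiv e.symm⟩

/-- Let `K^• : 0 → K^0 → ⋯ → K^p → 0` be a bounded cochain complex of graded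
`R`-modules (given degreewise) such that each `K^i` has a Hilbert function over `A`,
and let `B` be an `A`-algebra.  Then the cohomology modules `H^i(K^• ⊗_A B)` have
Hilbert functions over `B` for all `0 ≤ i ≤ p` if and only if the cokernel modules
`C^i(K^•) ⊗_A B` have Hilbert functions over `B` for all `0 ≤ i ≤ p`. -/
theorem cohomology_hasHilbertFunction_iff_cokernels (A : Type) [CommRing A]
    (B : Type) [CommRing B] [Algebra A B] (p : ℕ)
    (K : ℕ → ℤ → Type) [∀ i ν, AddCommGroup (K i ν)] [∀ i ν, Module A (K i ν)]
    (d : ∀ i ν, K i ν →ₗ[A] K (i + 1) ν)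
    (hcplx : ∀ i ν, (d (i + 1) ν).comp (d i ν) = 0)
    (hbdd : ∀ i, p < i → ∀ ν, Subsingleton (K i ν))
    (hHF : ∀ i ν, ∃ n, IsLocallyFreeOfRank A (K i ν) n) :
    (∀ i ≤ p, ∀ ν, ∃ n, IsLocallyFreeOfRank B (cohomologyBC A B K d i ν) n) ↔
      (∀ i ≤ p, ∀ ν, ∃ n,
        IsLocallyFreeOfRank B (B ⊗[A] (K i ν ⧸ coboundaries A K d i ν)) n) := by
  have hbig : ∀ i, p < i → ∀ ν, ∃ n,
      IsLocallyFreeOfRank B (B ⊗[A] (K i ν ⧸ coboundaries A K d i ν)) n := by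
    intro i hi ν
    have := hbdd i hi ν
    have : Subsingleton (K i ν ⧸ coboundaries A K d i ν) :=
      (Submodule.mkQ_surjective _).subsingleton
    exact islf_baseChange islf_subsingleton
  constructor
  · intro h
    have key : ∀ k i, p + 1 ≤ i + k → ∀ ν, ∃ n,
        IsLocallyFreeOfRank B (B ⊗[A] (K i ν ⧸ coboundaries A K d i ν)) n := by
      intro k
      induction k with
      | zero => exact fun i hi => hbig i (by omega)
      | succ k ih =>
        intro i hi ν
        by_cases hip : i ≤ p
        · exact (islf_step A B K d hcplx hHF i ν (ih (i + 1) (by omega) ν)).1 (h i hip ν)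
        · exact hbig i (by omega) ν
    exact fun i _ => key (p + 1) i (by omega)
  · intro h i hi ν
    refine (islf_step A B K d hcplx hHF i ν ?_).2 (h i hi ν)
    by_cases hip : i + 1 ≤ p
    · exact h _ hip ν
    · exact hbig _ (by omega) ν
end

section
/- Let K^• : 0 → K^0 → ⋯ → K^p → 0 be a bounded complex of graded R-modules such that each graded component [K^i]_ν is a finitely generated locally free A-module, and let B be an A-algebra. Then each graded component [H^i(K^• ⊗_A B)]_ν is a flat B-module for all i, ν if and only if each [H^i(K^• ⊗_A B)]_ν is a locally free B-module for all i, ν. -/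
open TensorProduct

/-- A retraction onto the kernel of a linear map that admits a section onto its range. -/
theorem exists_ker_retraction {B M N : Type} [CommRing B] [AddCommGroup M] [Module B M]
    [AddCommGroup N] [Module B N] (g : M →ₗ[B] N) (t : N →ₗ[B] M)
    (ht : g.comp t = LinearMap.id) :
    ∃ r : M →ₗ[B] LinearMap.ker g, r.comp (LinearMap.ker g).subtype = LinearMap.id ∧
      ∀ x, ((r x : LinearMap.ker g) : M) = x - t (g x) := by
  refine ⟨LinearMap.codRestrict _ (LinearMap.id - t.comp g) ?_, ?_, ?_⟩
  · intro x
    have := LinearMap.congr_fun ht (g x)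
    simp at this
    simp [this]
  · ext x
    have := x.2
    simp [LinearMap.mem_ker.1 x.2]
  · intro x
    simp

/-- A product of two flat modules is flat. -/
theorem flat_prod_aux {B P Q : Type} [CommRing B] [AddCommGroup P] [Module B P]
    [AddCommGroup Q] [Module B Q] [Module.Flat B P] [Module.Flat B Q] :
    Module.Flat B (P × Q) := by
  rw [Module.Flat.iff_rTensor_preserves_injective_linearMap]
  intro N N' _ _ _ _ f hf
  rw [injective_iff_map_eq_zero]
  intro x hx
  have h1 : (LinearMap.fst B P Q).lTensor N x = 0 := by
    apply Module.Flat.rTensor_preserves_injective_linearMap (M := P) f hf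
    rw [← LinearMap.comp_apply, LinearMap.rTensor_comp_lTensor,
      ← LinearMap.lTensor_comp_rTensor, LinearMap.comp_apply, hx, map_zero, map_zero]
  have h2 : (LinearMap.snd B P Q).lTensor N x = 0 := by
    apply Module.Flat.rTensor_preserves_injective_linearMap (M := Q) f hf
    rw [← LinearMap.comp_apply, LinearMap.rTensor_comp_lTensor,
      ← LinearMap.lTensor_comp_rTensor, LinearMap.comp_apply, hx, map_zero, map_zero]
  have h3 : x = (LinearMap.inl B P Q).lTensor N ((LinearMap.fst B P Q).lTensor N x) +
      (LinearMap.inr B P Q).lTensor N ((LinearMap.snd B P Q).lTensor N x) := by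
    rw [← LinearMap.lTensor_comp_apply, ← LinearMap.lTensor_comp_apply,
      ← LinearMap.add_apply, ← LinearMap.lTensor_add]
    have : (LinearMap.inl B P Q).comp (LinearMap.fst B P Q) +
        (LinearMap.inr B P Q).comp (LinearMap.snd B P Q) = LinearMap.id := by
      ext <;> simp
    rw [this, LinearMap.lTensor_id, LinearMap.id_apply]
  rw [h3, h1, h2, map_zero, map_zero, add_zero]

/-- The inductive step: one degree of the complex. -/
theorem flat_step {B M N : Type} [CommRing B] [AddCommGroup M] [Module B M]
    [AddCommGroup N] [Module B N] (f : M →ₗ[B] N) (S : Submodule B M) (hS : S.FG)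
    (hSf : S ≤ LinearMap.ker f) [Module.Finite B M] [Module.Projective B M]
    [Module.Projective B N]
    (hC : Module.Projective B (N ⧸ LinearMap.range f))
    (hH : Module.Flat B ((LinearMap.ker f).map S.mkQ)) :
    Module.Projective B (M ⧸ S) ∧ Module.Finite B ((LinearMap.ker f).map S.mkQ) ∧
      Module.Projective B ((LinearMap.ker f).map S.mkQ) := by
  rw [← Submodule.ker_liftQ S f hSf] at hH ⊢
  have hrange : LinearMap.range (S.liftQ f hSf) = LinearMap.range f :=
    Submodule.range_liftQ S f hSf
  rw [← hrange] at hC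
  generalize S.liftQ f hSf = g at *
  obtain ⟨s, hs⟩ := Module.projective_lifting_property (LinearMap.range g).mkQ
    (LinearMap.id) (Submodule.mkQ_surjective _)
  obtain ⟨r, hr, -⟩ := exists_ker_retraction _ s hs
  have hP : Module.Projective B (LinearMap.range g) := by
    have h1 : Module.Projective B (LinearMap.ker (LinearMap.range g).mkQ) :=
      Module.Projective.of_split _ r hr
    rwa [Submodule.ker_mkQ] at h1
  obtain ⟨t, ht⟩ := Module.projective_lifting_property g.rangeRestrict
    (LinearMap.id) g.surjective_rangeRestrict
  obtain ⟨q, hq, hq'⟩ := exists_ker_retraction _ t ht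
  have hH' : Module.Flat B (LinearMap.ker g.rangeRestrict) := by
    rwa [LinearMap.ker_rangeRestrict]
  rw [← LinearMap.ker_rangeRestrict g]
  have hfl : Module.Flat B (M ⧸ S) := by
    have := flat_prod_aux (B := B) (P := LinearMap.ker g.rangeRestrict)
      (Q := LinearMap.range g)
    refine Module.Flat.of_retract (M := LinearMap.ker g.rangeRestrict × LinearMap.range g)
      (LinearMap.prod q g.rangeRestrict)
      (LinearMap.coprod (LinearMap.ker g.rangeRestrict).subtype t) ?_
    ext x
    simp [hq']
  have : Module.FinitePresentation B M := Module.finitePresentation_of_projective B M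
  have : Module.FinitePresentation B (M ⧸ S) :=
    Module.finitePresentation_of_surjective S.mkQ S.mkQ_surjective (by simpa using hS)
  have hpr : Module.Projective B (M ⧸ S) := Module.Flat.projective_of_finitePresentation
  refine ⟨hpr, Module.Finite.of_surjective q ?_, Module.Projective.of_split _ q hq⟩
  intro y
  exact ⟨y, LinearMap.congr_fun hq y⟩

/-- Let `K^• : 0 → K^0 → ⋯ → K^p → 0` be a bounded complex of graded `R`-modules
(given degreewise) such that each graded component `[K^i]_ν` is a finitely generated
locally free `A`-module, and let `B` be an `A`-algebra.  Then each graded component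
`[H^i(K^• ⊗_A B)]_ν` is a flat `B`-module for all `i, ν` if and only if each
`[H^i(K^• ⊗_A B)]_ν` is a (finitely generated) locally free `B`-module for all
`i, ν`. -/
theorem cohomology_flat_iff_locallyFree (A : Type) [CommRing A]
    (B : Type) [CommRing B] [Algebra A B] (p : ℕ)
    (K : ℕ → ℤ → Type) [∀ i ν, AddCommGroup (K i ν)] [∀ i ν, Module A (K i ν)]
    (d : ∀ i ν, K i ν →ₗ[A] K (i + 1) ν)
    (hcplx : ∀ i ν, (d (i + 1) ν).comp (d i ν) = 0)
    (hbdd : ∀ i, p < i → ∀ ν, Subsingleton (K i ν))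
    (hfree : ∀ i ν, Module.Finite A (K i ν) ∧ Module.Projective A (K i ν)) :
    (∀ i ν, Module.Flat B (cohomologyBC A B K d i ν)) ↔
      (∀ i ν, Module.Finite B (cohomologyBC A B K d i ν) ∧
        Module.Projective B (cohomologyBC A B K d i ν)) := by
  refine ⟨fun hfl => ?_, fun h i ν => ?_⟩
  swap
  · have := (h i ν).2
    infer_instance
  have hfin := fun i ν => (hfree i ν).1
  have hproj := fun i ν => (hfree i ν).2
  have hfg : ∀ i ν, (coboundariesBC A B K d i ν).FG := by
    intro i ν
    cases i with
    | zero => exact Submodule.fg_bot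
    | succ j => 
      have h := (Module.Finite.fg_top (R := B) (M := B ⊗[A] K j ν)).map
        (LinearMap.baseChange B (d j ν))
      rwa [Submodule.map_top] at h
  have hle : ∀ i ν, coboundariesBC A B K d i ν ≤
      LinearMap.ker (LinearMap.baseChange B (d i ν)) := by
    intro i ν
    cases i with
    | zero => exact bot_le
    | succ j =>
      refine LinearMap.range_le_ker_iff.2 ?_
      rw [← LinearMap.baseChange_comp, hcplx, LinearMap.baseChange_zero]
  have step := fun i ν (hC : Module.Projective B
      ((B ⊗[A] K (i + 1) ν) ⧸ coboundariesBC A B K d (i + 1) ν)) =>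
    flat_step (LinearMap.baseChange B (d i ν)) _ (hfg i ν) (hle i ν) hC (hfl i ν)
  have base : ∀ i ν, p < i →
      Module.Projective B ((B ⊗[A] K i ν) ⧸ coboundariesBC A B K d i ν) := by
    intro i ν hi
    have := hbdd i hi ν
    infer_instance
  have key : ∀ n i ν, p < i + n →
      Module.Projective B ((B ⊗[A] K i ν) ⧸ coboundariesBC A B K d i ν) := by
    intro n
    induction n with
    | zero => exact fun i ν hi => base i ν hi
    | succ n ih => exact fun i ν hi => (step i ν (ih (i + 1) ν (by omega))).1
  intro i ν
  exact (step i ν (key (p + 1) (i + 1) ν (by omega))).2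
end

section
/- Let A be a Noetherian ring, R a finitely generated graded A-algebra, and M a finitely generated graded R-module. Then there exist only finitely many distinct functions h_1, …, h_m : Z → N such that the locally closed stratum F_M^{h_i} ⊂ Spec(A) (parametrizing points p where M ⊗_A κ(p) has Hilbert function h_i) is nonempty, and Spec(A) is set-theoretically the disjoint union of the F_M^{h_i}. In particular, the function p ↦ (ν ↦ dim_{κ(p)} [M ⊗_A κ(p)]_ν) takes only finitely many values on Spec(A). -/
open TensorProduct

namespace HilbStrata

theorem field_li {K V I : Type*} [Field K] [AddCommGroup V] [Module K V] [LinearOrder I]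
    (v : I → V) :
    LinearIndependent K (fun i : {i | v i ∉ Submodule.span K (v '' Set.Iio i)} => v i) := by
  classical
  rw [linearIndependent_iff]
  intro c hc
  by_contra hne
  have hs : c.support.Nonempty := Finsupp.support_nonempty_iff.mpr hne
  set k := c.support.max' hs with hk
  have hkm : k ∈ c.support := Finset.max'_mem _ _
  have hck : c k ≠ 0 := Finsupp.mem_support_iff.mp hkm
  apply k.2
  rw [Finsupp.linearCombination_apply, Finsupp.sum, ← Finset.add_sum_erase _ _ hkm] at hc
  have h1 : c k • v k ∈ Submodule.span K (v '' Set.Iio k.1) := by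
    rw [eq_neg_of_add_eq_zero_left hc]
    refine neg_mem (sum_mem fun j hj => Submodule.smul_mem _ _ (Submodule.subset_span ⟨j, ?_, rfl⟩))
    rw [Finset.mem_erase] at hj
    exact lt_of_le_of_ne (Finset.le_max' _ _ hj.2) (fun h => hj.1 (Subtype.ext h))
  exact (Submodule.smul_mem_iff _ hck).mp h1

theorem field_span {K V I : Type*} [Field K] [AddCommGroup V] [Module K V] [LinearOrder I]
    [WellFoundedLT I] (v : I → V) (j : I) :
    v j ∈ Submodule.span K
      (Set.range (fun i : {i | v i ∉ Submodule.span K (v '' Set.Iio i)} => v i)) := by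
  induction j using WellFoundedLT.induction with
  | ind j ih =>
    by_cases h : v j ∈ Submodule.span K (v '' Set.Iio j)
    · refine Submodule.span_le.mpr ?_ h
      rintro _ ⟨l, hl, rfl⟩
      exact ih l hl
    · exact Submodule.subset_span ⟨⟨j, h⟩, rfl⟩

/-- kernel of `M → κ(p) ⊗ M`. -/
theorem ker_fiber {A M : Type*} [CommRing A] [AddCommGroup M] [Module A M] (p : Ideal A)
    [p.IsPrime] (x : M) (hx : (1 : p.ResidueField) ⊗ₜ[A] x = 0) :
    ∃ s, s ∉ p ∧ s • x ∈ p • (⊤ : Submodule A M) := by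
  have h1 : IsLocalizedModule (nonZeroDivisors (A ⧸ p))
      (TensorProduct.mk (A ⧸ p) p.ResidueField ((A ⧸ p) ⊗[A] M) 1) := by
    rw [isLocalizedModule_iff_isBaseChange (nonZeroDivisors (A ⧸ p)) p.ResidueField]
    exact TensorProduct.isBaseChange _ _ _
  have h2 : (TensorProduct.mk (A ⧸ p) p.ResidueField ((A ⧸ p) ⊗[A] M) 1) (1 ⊗ₜ x) = 0 := by
    apply (TensorProduct.AlgebraTensorModule.cancelBaseChange A (A ⧸ p) (A ⧸ p)
      p.ResidueField M).injective
    simp [hx]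
  obtain ⟨⟨s, hs⟩, h3⟩ := (IsLocalizedModule.eq_zero_iff (nonZeroDivisors (A ⧸ p)) _).mp h2
  obtain ⟨s, rfl⟩ := Ideal.Quotient.mk_surjective s
  refine ⟨s, fun h => ?_, ?_⟩
  · exact nonZeroDivisors.ne_zero hs (Ideal.Quotient.eq_zero_iff_mem.mpr h)
  · have h4 : (1 : A ⧸ p) ⊗ₜ[A] (s • x) = 0 := by
      rw [TensorProduct.tmul_smul, ← h3]
      simp [Submonoid.smul_def, TensorProduct.smul_tmul', Algebra.smul_def]
    have := congrArg (TensorProduct.quotTensorEquivQuotSMul M p) h4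
    rw [map_zero] at this
    have h5 := TensorProduct.quotTensorEquivQuotSMul_mk_tmul (M := M) p 1 (s • x)
    rw [map_one] at h5
    rw [h5, one_smul] at this
    exact (Submodule.Quotient.mk_eq_zero _).mp this

theorem descend {A M I : Type*} [CommRing A] [AddCommGroup M] [Module A M] (p : Ideal A)
    [p.IsPrime] (m : I → M) (J : Set I) (x : M)
    (hx : (1 : p.ResidueField) ⊗ₜ[A] x ∈
      Submodule.span p.ResidueField ((fun j => (1 : p.ResidueField) ⊗ₜ[A] m j) '' J)) :
    ∃ s, s ∉ p ∧ s • x ∈ Submodule.span A (m '' J) ⊔ p • (⊤ : Submodule A M) := by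
  have key : ∀ y ∈ Submodule.span p.ResidueField
      ((fun j => (1 : p.ResidueField) ⊗ₜ[A] m j) '' J),
      ∃ s, s ∉ p ∧ ∃ w ∈ Submodule.span A (m '' J), s • y = (1 : p.ResidueField) ⊗ₜ[A] w := by
    intro y hy
    induction hy using Submodule.span_induction with
    | mem y h =>
      obtain ⟨j, hj, rfl⟩ := h
      exact ⟨1, p.one_notMem, m j, Submodule.subset_span ⟨j, hj, rfl⟩, by simp⟩
    | zero => exact ⟨1, p.one_notMem, 0, zero_mem _, by simp⟩
    | add y z _ _ h1 h2 =>
      obtain ⟨s, hs, w, hw, e⟩ := h1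
      obtain ⟨s', hs', w', hw', e'⟩ := h2
      refine ⟨s * s', p.primeCompl.mul_mem hs hs', s' • w + s • w',
        add_mem (Submodule.smul_mem _ _ hw) (Submodule.smul_mem _ _ hw'), ?_⟩
      rw [TensorProduct.tmul_add, TensorProduct.tmul_smul, TensorProduct.tmul_smul, ← e, ← e',
        smul_add, mul_smul, mul_smul, smul_comm s s' y]
    | smul c y _ h1 =>
      obtain ⟨s, hs, w, hw, e⟩ := h1
      obtain ⟨⟨a, t⟩, h⟩ := IsLocalization.surj (nonZeroDivisors (A ⧸ p)) c
      obtain ⟨t, ht⟩ := t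
      obtain ⟨t, rfl⟩ := Ideal.Quotient.mk_surjective t
      obtain ⟨a, rfl⟩ := Ideal.Quotient.mk_surjective a
      have ht' : t ∉ p := fun h =>
        nonZeroDivisors.ne_zero ht (Ideal.Quotient.eq_zero_iff_mem.mpr h)
      refine ⟨t * s, p.primeCompl.mul_mem ht' hs, a • w, Submodule.smul_mem _ _ hw, ?_⟩
      simp only [Ideal.algebraMap_quotient_residueField_mk] at h
      rw [TensorProduct.tmul_smul, ← e, ← algebraMap_smul p.ResidueField a (s • y), ← h,
        mul_comm c, mul_smul, mul_smul, algebraMap_smul, smul_comm s c y]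
  obtain ⟨s, hs, w, hw, e⟩ := key _ hx
  have : (1 : p.ResidueField) ⊗ₜ[A] (s • x - w) = 0 := by
    rw [TensorProduct.tmul_sub, TensorProduct.tmul_smul, e, sub_self]
  obtain ⟨t, ht, h⟩ := ker_fiber p _ this
  refine ⟨t * s, p.primeCompl.mul_mem ht hs, ?_⟩
  have h6 : (t * s) • x = t • w + t • (s • x - w) := by
    rw [smul_sub, mul_smul]; abel
  rw [h6]
  exact Submodule.add_mem_sup (Submodule.smul_mem _ _ hw) h

theorem tmul_zero_of_mem {A M : Type*} [CommRing A] [AddCommGroup M] [Module A M] (p q : Ideal A)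
    [q.IsPrime] (hpq : p ≤ q) (x : M) (hx : x ∈ p • (⊤ : Submodule A M)) :
    (1 : q.ResidueField) ⊗ₜ[A] x = 0 := by
  refine Submodule.smul_induction_on hx ?_ ?_
  · intro r hr n _
    rw [← TensorProduct.smul_tmul, Algebra.smul_def, mul_one,
      Ideal.algebraMap_residueField_eq_zero.mpr (hpq hr), TensorProduct.zero_tmul]
  · intro x y hx hy
    rw [TensorProduct.tmul_add, hx, hy, add_zero]

/-- Image of `A`-span after tensoring. -/
theorem smul_tmul_mem {A M I : Type*} [CommRing A] [AddCommGroup M] [Module A M] (p q : Ideal A)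
    [q.IsPrime] (hpq : p ≤ q) (m : I → M) (J : Set I) (x : M)
    (hx : x ∈ Submodule.span A (m '' J) ⊔ p • (⊤ : Submodule A M)) :
    (1 : q.ResidueField) ⊗ₜ[A] x ∈
      Submodule.span A ((fun j => (1 : q.ResidueField) ⊗ₜ[A] m j) '' J) := by
  obtain ⟨y, hy, z, hz, rfl⟩ := Submodule.mem_sup.mp hx
  rw [TensorProduct.tmul_add, tmul_zero_of_mem p q hpq z hz, add_zero]
  have := Submodule.mem_map_of_mem (f := TensorProduct.mk A q.ResidueField M 1) hy
  rw [Submodule.map_span, ← Set.image_comp] at this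
  exact this

/-- reducible indices -/
def Red {A M I : Type*} [CommRing A] [AddCommGroup M] [Module A M] [LinearOrder I]
    (m : I → M) (p : Ideal A) [p.IsPrime] : Set I :=
  {i | (1 : p.ResidueField) ⊗ₜ[A] m i ∈
    Submodule.span p.ResidueField ((fun j => (1 : p.ResidueField) ⊗ₜ[A] m j) '' Set.Iio i)}

theorem mem_red_of {A M I : Type*} [CommRing A] [AddCommGroup M] [Module A M] [LinearOrder I]
    (m : I → M) (p q : Ideal A) [q.IsPrime] (hpq : p ≤ q) (i : I) (s : A) (hs : s ∉ q)
    (h : s • m i ∈ Submodule.span A (m '' Set.Iio i) ⊔ p • (⊤ : Submodule A M)) :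
    i ∈ Red m q := by
  have h1 := smul_tmul_mem p q hpq m _ _ h
  have h2 := Submodule.span_le_restrictScalars A q.ResidueField _ h1
  rw [Submodule.restrictScalars_mem, TensorProduct.tmul_smul,
    ← algebraMap_smul q.ResidueField s] at h2
  exact (Submodule.smul_mem_iff _
    (fun h => hs (Ideal.algebraMap_residueField_eq_zero.mp h))).mp h2

theorem generic {A M I T : Type*} [CommRing A] [AddCommGroup M] [Module A M] [LinearOrder I]
    [WellFoundedLT I] (m : I → M) (hm : Submodule.span A (Set.range m) = ⊤)
    (τ : T → I → I) (hτ : ∀ t, StrictMono (τ t)) (L : T → M →ₗ[A] M)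
    (hL : ∀ t i, L t (m i) = m (τ t i))
    (hfin : ∀ D : Set I, ∃ G : Finset I, ↑G ⊆ D ∧ ∀ i ∈ D, ∃ g ∈ G, ∃ t, τ t g = i)
    (p : Ideal A) [p.IsPrime] :
    ∃ f, f ∉ p ∧ ∀ (q : Ideal A) [q.IsPrime], p ≤ q → f ∉ q → Red m q = Red m p := by
  classical
  obtain ⟨G, hG, hGD⟩ := hfin (Red m p)
  have h0 : ∀ g, ∃ s, s ∉ p ∧ (g ∈ G → s • m g ∈ Submodule.span A (m '' Set.Iio g) ⊔
      p • (⊤ : Submodule A M)) := by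
    intro g
    by_cases hg : g ∈ G
    · obtain ⟨s, hs, h⟩ := descend p m _ _ (hG hg)
      exact ⟨s, hs, fun _ => h⟩
    · exact ⟨1, p.one_notMem, fun h => absurd h hg⟩
  choose s hs hsm using h0
  refine ⟨∏ g ∈ G, s g, p.primeCompl.prod_mem fun g _ => hs g, ?_⟩
  intro q _ hpq hfq
  have hsq : ∀ g ∈ G, s g ∉ q := fun g hg h =>
    hfq (q.mem_of_dvd (Finset.dvd_prod_of_mem s hg) h)
  -- every reducible index has a relation
  have hrel : ∀ i ∈ Red m p, ∃ g ∈ G, s g • m i ∈ Submodule.span A (m '' Set.Iio i) ⊔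
      p • (⊤ : Submodule A M) := by
    intro i hi
    obtain ⟨g, hg, t, rfl⟩ := hGD i hi
    refine ⟨g, hg, ?_⟩
    have h1 := Submodule.mem_map_of_mem (f := L t) (hsm g hg)
    rw [map_smul, hL, Submodule.map_sup, Submodule.map_span, Submodule.map_smul''] at h1
    refine (sup_le_sup (c := p • Submodule.map (L t) ⊤) (d := p • (⊤ : Submodule A M))
      (Submodule.span_mono ?_) (Submodule.smul_mono le_rfl le_top)) h1
    rintro _ ⟨_, ⟨l, hl, rfl⟩, rfl⟩
    exact ⟨τ t l, hτ t hl, (hL t l).symm⟩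
  apply Set.Subset.antisymm
  swap
  · intro i hi
    obtain ⟨g, hg, h⟩ := hrel i hi
    exact mem_red_of m p q hpq i (s g) (hsq g hg) h
  · intro i hiq
    by_contra hip
    -- the coordinate functional
    set v : I → p.ResidueField ⊗[A] M := fun j => 1 ⊗ₜ m j with hv
    have hspan : ⊤ ≤ Submodule.span p.ResidueField
        (Set.range (fun i : {i | v i ∉ Submodule.span p.ResidueField (v '' Set.Iio i)} => v i)) := by
      rw [← Submodule.baseChange_top, ← hm, Submodule.baseChange_span, Submodule.span_le]
      rintro _ ⟨_, ⟨j, rfl⟩, rfl⟩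
      exact field_span v j
    let b := Module.Basis.mk (field_li (K := p.ResidueField) v) hspan
    let e := b.coord ⟨i, hip⟩
    have he : ∀ j (hj : j ∉ Red m p), e (v j) = if j = i then 1 else 0 := by
      intro j hj
      have : v j = b ⟨j, hj⟩ := by simp [b]
      rw [this, Module.Basis.coord_apply, Module.Basis.repr_self, Finsupp.single_apply]
      simp [Subtype.ext_iff]
    have hlt : ∀ j < i, e (v j) = 0 := by
      intro j
      induction j using WellFoundedLT.induction with
      | ind j ih =>
        intro hji
        by_cases h : j ∈ Red m p
        · have h' : v j ∈ Submodule.span p.ResidueField (v '' Set.Iio j) := h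
          have : Submodule.span p.ResidueField (v '' Set.Iio j) ≤ LinearMap.ker e := by
            rw [Submodule.span_le]
            rintro _ ⟨l, hl, rfl⟩
            exact ih l hl (lt_trans hl hji)
          exact this h'
        · rw [he j h, if_neg hji.ne]
    -- the ring B
    let fb : A ⧸ p := Ideal.Quotient.mk p (∏ g ∈ G, s g)
    have hfb : fb ≠ 0 := fun h => (p.primeCompl.prod_mem fun g _ => hs g)
      (Ideal.Quotient.eq_zero_iff_mem.mp h)
    let B := Localization.Away fb
    let φp : B →+* p.ResidueField := IsLocalization.Away.lift (S := B) fb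
      (g := algebraMap (A ⧸ p) p.ResidueField) (by
        rw [isUnit_iff_ne_zero]
        exact fun h => hfb ((injective_iff_map_eq_zero _).mp
          (Ideal.injective_algebraMap_quotient_residueField p) _ h))
    let φq : B →+* q.ResidueField := IsLocalization.Away.lift (S := B) fb
      (g := Ideal.Quotient.lift p (algebraMap A q.ResidueField)
        (fun a ha => Ideal.algebraMap_residueField_eq_zero.mpr (hpq ha))) (by
        rw [isUnit_iff_ne_zero]
        intro h
        rw [Ideal.Quotient.lift_mk] at h
        exact hfq (Ideal.algebraMap_residueField_eq_zero.mp h))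
    have hφp : Function.Injective φp := by
      rw [injective_iff_map_eq_zero]
      intro z hz
      obtain ⟨⟨x, u⟩, hxu⟩ := IsLocalization.surj (Submonoid.powers fb) z
      have hx : φp (algebraMap (A ⧸ p) B x) = 0 := by
        rw [← hxu, map_mul, hz, zero_mul]
      rw [IsLocalization.Away.lift_eq] at hx
      rw [← (IsLocalization.map_units B u).mul_left_eq_zero, hxu]
      dsimp only
      rw [(injective_iff_map_eq_zero _).mp
        (Ideal.injective_algebraMap_quotient_residueField p) _ hx, map_zero]
    have hAp : ∀ a : A, φp (algebraMap A B a) = algebraMap A p.ResidueField a := by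
      intro a
      rw [IsScalarTower.algebraMap_apply A (A ⧸ p) B, IsLocalization.Away.lift_eq,
        ← IsScalarTower.algebraMap_apply]
    have hAq : ∀ a : A, φq (algebraMap A B a) = algebraMap A q.ResidueField a := by
      intro a
      rw [IsScalarTower.algebraMap_apply A (A ⧸ p) B, IsLocalization.Away.lift_eq]
      rfl
    let ψp : B →ₐ[A] p.ResidueField := { φp with commutes' := hAp }
    let ψq : B →ₐ[A] q.ResidueField := { φq with commutes' := hAq }
    have hψ : Function.Injective ψp.toLinearMap := hφp
    have hunit : ∀ g ∈ G, IsUnit (algebraMap A B (s g)) := by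
      intro g hg
      refine isUnit_of_dvd_unit ?_ (IsLocalization.Away.algebraMap_isUnit (S := B) fb)
      have : algebraMap (A ⧸ p) B fb = algebraMap A B (∏ g ∈ G, s g) := by
        rw [IsScalarTower.algebraMap_apply A (A ⧸ p) B]; rfl
      rw [this]
      exact map_dvd _ (Finset.dvd_prod_of_mem s hg)
    -- integrality
    have hint : ∀ j, e (v j) ∈ LinearMap.range ψp.toLinearMap := by
      intro j
      induction j using WellFoundedLT.induction with
      | ind j ih =>
        by_cases h : j ∈ Red m p
        · obtain ⟨g, hg, h1⟩ := hrel j h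
          have h2 := smul_tmul_mem p p le_rfl m _ _ h1
          have h3 : Submodule.span A (v '' Set.Iio j) ≤
              (LinearMap.range ψp.toLinearMap).comap (e.restrictScalars A) := by
            rw [Submodule.span_le]
            rintro _ ⟨l, hl, rfl⟩
            exact ih l hl
          obtain ⟨y, hy⟩ := h3 h2
          obtain ⟨u, hu⟩ := hunit g hg
          refine ⟨↑u⁻¹ * y, ?_⟩
          have hy' : ψp y = ψp u * e (v j) := by
            rw [hu, AlgHom.commutes, ← Algebra.smul_def]
            refine hy.trans ?_
            rw [TensorProduct.tmul_smul, map_smul]; rfl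
          show ψp (↑u⁻¹ * y) = _
          rw [map_mul, hy', ← mul_assoc, ← map_mul, Units.inv_mul, map_one, one_mul]
        · rw [he j h]
          split_ifs
          · exact ⟨1, map_one ψp⟩
          · exact zero_mem _
    let e' : M →ₗ[A] p.ResidueField := e.restrictScalars A ∘ₗ TensorProduct.mk A p.ResidueField M 1
    have hint' : ∀ x, e' x ∈ LinearMap.range ψp.toLinearMap := by
      intro x
      have : (⊤ : Submodule A M) ≤ (LinearMap.range ψp.toLinearMap).comap e' := by
        rw [← hm, Submodule.span_le]
        rintro _ ⟨j, rfl⟩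
        exact hint j
      exact this Submodule.mem_top
    let E : M →ₗ[A] q.ResidueField := ψq.toLinearMap ∘ₗ
      (LinearEquiv.ofInjective ψp.toLinearMap hψ).symm.toLinearMap ∘ₗ e'.codRestrict _ hint'
    have hE : ∀ x y, e' x = ψp y → E x = ψq y := by
      intro x y h
      show ψq ((LinearEquiv.ofInjective ψp.toLinearMap hψ).symm (e'.codRestrict _ hint' x)) = _
      congr 1
      rw [LinearEquiv.symm_apply_eq]
      exact Subtype.ext h
    have hE1 : E (m i) = 1 := by
      rw [hE (m i) 1, map_one]
      rw [map_one]
      exact (he i hip).trans (if_pos rfl)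
    have hE0 : ∀ j < i, E (m j) = 0 := by
      intro j hj
      rw [hE (m j) 0, map_zero]
      rw [map_zero]
      exact hlt j hj
    let E' : q.ResidueField ⊗[A] M →ₗ[q.ResidueField] q.ResidueField :=
      LinearMap.liftBaseChange q.ResidueField E
    have : Submodule.span q.ResidueField
        ((fun j => (1 : q.ResidueField) ⊗ₜ[A] m j) '' Set.Iio i) ≤ LinearMap.ker E' := by
      rw [Submodule.span_le]
      rintro _ ⟨l, hl, rfl⟩
      simp [E', hE0 l hl]
    have h1 := this hiq
    simp [E', hE1] at h1

theorem finite_values {A X : Type*} [CommRing A] [IsNoetherianRing A]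
    (F : PrimeSpectrum A → X)
    (h : ∀ p : PrimeSpectrum A, ∃ f, f ∉ p.asIdeal ∧ ∀ q : PrimeSpectrum A,
      p.asIdeal ≤ q.asIdeal → f ∉ q.asIdeal → F q = F p) : (Set.range F).Finite := by
  have key : ∀ J : Ideal A, (F '' {q | J ≤ q.asIdeal}).Finite := by
    intro J
    induction J using WellFoundedGT.induction with
    | ind J ih =>
      by_cases hJ : J.IsPrime
      · obtain ⟨f, hf, hq⟩ := h ⟨J, hJ⟩
        have h1 := ih (J ⊔ Ideal.span {f}) (by
          refine lt_of_le_of_ne le_sup_left fun h => hf ?_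
          show f ∈ J
          rw [h]
          exact le_sup_right (a := J) (Ideal.mem_span_singleton_self f))
        refine (h1.union (Set.finite_singleton (F ⟨J, hJ⟩))).subset ?_
        rintro _ ⟨q, hJq, rfl⟩
        by_cases hfq : f ∈ q.asIdeal
        · left
          exact ⟨q, sup_le hJq ((Ideal.span_singleton_le_iff_mem _).mpr hfq), rfl⟩
        · right
          exact hq q hJq hfq
      · by_cases htop : J = ⊤
        · convert Set.finite_empty
          rw [Set.image_eq_empty]
          ext q
          simp only [Set.mem_ofPred_eq, Set.mem_empty_iff_false, iff_false, htop, top_le_iff]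
          exact q.2.ne_top
        · rw [Ideal.isPrime_iff] at hJ
          push Not at hJ
          obtain ⟨x, y, hxy, hx, hy⟩ := hJ htop
          have aux : ∀ z ∉ J, (F '' {q | J ⊔ Ideal.span {z} ≤ q.asIdeal}).Finite := by
            intro z hz
            refine ih _ (lt_of_le_of_ne le_sup_left fun h => hz ?_)
            rw [h]
            exact le_sup_right (a := J) (Ideal.mem_span_singleton_self z)
          refine ((aux x hx).union (aux y hy)).subset ?_
          rintro _ ⟨q, hJq, rfl⟩
          rcases q.2.mem_or_mem (hJq hxy) with h | h
          · exact Or.inl ⟨q, sup_le hJq ((Ideal.span_singleton_le_iff_mem _).mpr h), rfl⟩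
          · exact Or.inr ⟨q, sup_le hJq ((Ideal.span_singleton_le_iff_mem _).mpr h), rfl⟩
  refine (key ⊥).subset ?_
  rintro _ ⟨q, rfl⟩
  exact ⟨q, bot_le (α := Ideal A), rfl⟩

/-- dimension count in a degree -/
theorem finrank_eq {A M I : Type*} [CommRing A] [AddCommGroup M] [Module A M] [LinearOrder I]
    [WellFoundedLT I] (m : I → M) (hm : Submodule.span A (Set.range m) = ⊤)
    (𝓜 : ℤ → Submodule A M) [DirectSum.Decomposition 𝓜] (d : I → ℤ) (hd : ∀ i, m i ∈ 𝓜 (d i))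
    (p : Ideal A) [p.IsPrime] (ν : ℤ) :
    Module.finrank p.ResidueField ((𝓜 ν).baseChange p.ResidueField) =
      Nat.card {i // i ∉ Red m p ∧ d i = ν} := by
  classical
  set v : I → p.ResidueField ⊗[A] M := fun j => 1 ⊗ₜ m j with hv
  have hspan : ⊤ ≤ Submodule.span p.ResidueField
      (Set.range (fun i : {i | v i ∉ Submodule.span p.ResidueField (v '' Set.Iio i)} => v i)) := by
    rw [← Submodule.baseChange_top, ← hm, Submodule.baseChange_span, Submodule.span_le]
    rintro _ ⟨_, ⟨j, rfl⟩, rfl⟩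
    exact field_span v j
  have hli : LinearIndependent p.ResidueField (fun i : {i // i ∉ Red m p ∧ d i = ν} => v i) :=
    (field_li (K := p.ResidueField) v).comp
      (fun i : {i // i ∉ Red m p ∧ d i = ν} => ⟨i.1, i.2.1⟩)
      (fun a b h => Subtype.ext (congrArg (fun z => z.1) h))
  let P : M →ₗ[A] M := (𝓜 ν).subtype ∘ₗ DirectSum.component A ℤ (fun i => 𝓜 i) ν ∘ₗ
    (DirectSum.decomposeLinearEquiv 𝓜).toLinearMap
  have hP : ∀ x, P x = (DirectSum.decompose 𝓜 x ν : M) := fun x => rfl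
  have heq : (𝓜 ν).baseChange p.ResidueField = Submodule.span p.ResidueField
      (Set.range (fun i : {i // i ∉ Red m p ∧ d i = ν} => v i)) := by
    apply le_antisymm
    · rw [Submodule.baseChange_eq_span, Submodule.span_le]
      rintro _ ⟨x, hx, rfl⟩
      have h1 : P.baseChange p.ResidueField (1 ⊗ₜ x) = 1 ⊗ₜ x := by
        rw [LinearMap.baseChange_tmul, hP, DirectSum.decompose_of_mem_same _ hx]
      have h2 := Submodule.mem_map_of_mem (f := P.baseChange p.ResidueField)
        (hspan (Submodule.mem_top (x := (1 : p.ResidueField) ⊗ₜ[A] x)))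
      rw [h1, Submodule.map_span] at h2
      refine Submodule.span_le.mpr ?_ h2
      rintro _ ⟨_, ⟨i, rfl⟩, rfl⟩
      show P.baseChange p.ResidueField (1 ⊗ₜ m i.1) ∈ _
      rw [LinearMap.baseChange_tmul, hP]
      by_cases hi : d i = ν
      · rw [DirectSum.decompose_of_mem_same _ (hi ▸ hd i)]
        exact Submodule.subset_span ⟨⟨i.1, i.2, hi⟩, rfl⟩
      · rw [DirectSum.decompose_of_mem_ne _ (hd i) hi, TensorProduct.tmul_zero]
        exact zero_mem _
    · rw [Submodule.span_le]
      rintro _ ⟨⟨i, _, rfl⟩, rfl⟩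
      exact Submodule.tmul_mem_baseChange_of_mem _ (hd i)
  rw [heq]
  exact Module.finrank_eq_nat_card_basis (Module.Basis.span hli)

theorem exists_gens_ring {A R : Type*} [CommRing A] [CommRing R] [Algebra A R]
    (𝓡 : ℤ → Submodule A R) [GradedAlgebra 𝓡] (hRft : Algebra.FiniteType A R) :
    ∃ (n : ℕ) (x : Fin n → R) (d : Fin n → ℤ), (∀ i, x i ∈ 𝓡 (d i)) ∧
      Algebra.adjoin A (Set.range x) = ⊤ := by
  classical
  obtain ⟨F, hF⟩ := hRft.out
  let ι₀ := Σ (x : F), (DirectSum.decompose 𝓡 x.1).support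
  let x (i : ι₀) : R := ((DirectSum.decompose 𝓡) i.1 i.2).1
  let eq := Fintype.equivFin ι₀
  refine ⟨Fintype.card ι₀, fun i => x (eq.symm i), fun i => (eq.symm i).2,
    fun i => (DirectSum.decompose 𝓡 _ _).2, ?_⟩
  rw [← top_le_iff, ← hF, Algebra.adjoin_le_iff]
  intro s hs
  rw [← DirectSum.sum_support_decompose 𝓡 s]
  refine sum_mem fun n hn ↦ Algebra.subset_adjoin ⟨eq ⟨⟨s, hs⟩, ⟨n, hn⟩⟩, ?_⟩
  simp [x]

theorem exists_gens_module {A R M : Type*} [CommRing A] [CommRing R] [Algebra A R]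
    [AddCommGroup M] [Module A M] [Module R M] [Module.Finite R M]
    (𝓜 : ℤ → Submodule A M) [DirectSum.Decomposition 𝓜] :
    ∃ (n : ℕ) (x : Fin n → M) (d : Fin n → ℤ), (∀ i, x i ∈ 𝓜 (d i)) ∧
      Submodule.span R (Set.range x) = ⊤ := by
  classical
  obtain ⟨F, hF⟩ := Module.Finite.fg_top (R := R) (M := M)
  let ι₀ := Σ (x : F), (DirectSum.decompose 𝓜 x.1).support
  let x (i : ι₀) : M := ((DirectSum.decompose 𝓜) i.1 i.2).1
  let eq := Fintype.equivFin ι₀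
  refine ⟨Fintype.card ι₀, fun i => x (eq.symm i), fun i => (eq.symm i).2,
    fun i => (DirectSum.decompose 𝓜 _ _).2, ?_⟩
  rw [← top_le_iff, ← hF, Submodule.span_le]
  intro s hs
  rw [← DirectSum.sum_support_decompose 𝓜 s]
  refine sum_mem fun n hn ↦ Submodule.subset_span ⟨eq ⟨⟨s, hs⟩, ⟨n, hn⟩⟩, ?_⟩
  simp [x]

theorem dickson {k n : ℕ} (D : Set (Fin k × (Fin n →₀ ℕ))) :
    ∃ G : Finset (Fin k × (Fin n →₀ ℕ)), ↑G ⊆ D ∧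
      ∀ i ∈ D, ∃ g ∈ G, ∃ t, (g.1, t + g.2) = i := by
  classical
  have h : ∀ j : Fin k, {a | Minimal (fun a => (j, a) ∈ D) a}.Finite := fun j =>
    WellQuasiOrderedLE.finite_of_isAntichain (setOfPred_minimal_antichain _)
  refine ⟨Finset.univ.biUnion fun j => (h j).toFinset.image fun a => (j, a), ?_, ?_⟩
  · intro g hg
    simp only [Finset.coe_biUnion, Finset.coe_image, Set.Finite.coe_toFinset, Set.mem_iUnion] at hg
    obtain ⟨j, _, a, ha, rfl⟩ := hg
    exact ha.1
  · rintro ⟨j, a⟩ hi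
    obtain ⟨b, hb, hm⟩ := exists_minimal_le_of_wellFoundedLT (fun a => (j, a) ∈ D) a hi
    refine ⟨(j, b), ?_, a - b, ?_⟩
    · rw [Finset.mem_biUnion]
      exact ⟨j, Finset.mem_univ _, Finset.mem_image.mpr ⟨b, (h j).mem_toFinset.mpr hm, rfl⟩⟩
    · simp [tsub_add_cancel_of_le hb]

end HilbStrata

theorem hilbertFunction_strata_finite
    (A R : Type) [CommRing A] [IsNoetherianRing A] [CommRing R] [Algebra A R]
    (𝓡 : ℤ → Submodule A R) [GradedAlgebra 𝓡] (hRft : Algebra.FiniteType A R)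
    (M : Type) [AddCommGroup M] [Module A M] [Module R M] [IsScalarTower A R M]
    [Module.Finite R M]
    (𝓜 : ℤ → Submodule A M) [DirectSum.Decomposition 𝓜] [SetLike.GradedSMul 𝓡 𝓜] :
    {h : ℤ → ℕ | ∃ p : PrimeSpectrum A,
      h = fun ν => Module.finrank
        (IsLocalRing.ResidueField (Localization.AtPrime p.asIdeal))
        ((𝓜 ν).baseChange
          (IsLocalRing.ResidueField (Localization.AtPrime p.asIdeal)))}.Finite := by
  classical
  obtain ⟨n, x, dx, hx, hxtop⟩ := HilbStrata.exists_gens_ring 𝓡 hRft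
  obtain ⟨k, y, dy, hy, hytop⟩ := HilbStrata.exists_gens_module (R := R) 𝓜
  let mo : MonomialOrder (Fin n) := MonomialOrder.lex
  let I := Fin k ×ₗ mo.syn
  let X : (Fin n →₀ ℕ) → R := fun a => ∏ l, x l ^ a l
  have hX : ∀ a b, X (a + b) = X a * X b := by
    intro a b
    simp only [X, Finsupp.add_apply, pow_add, Finset.prod_mul_distrib]
  have hXd : ∀ a, X a ∈ 𝓡 (∑ l, a l • dx l) := fun a =>
    SetLike.prod_pow_mem_graded 𝓡 _ _ _ fun l _ => hx l
  have hXspan : Submodule.span A (Set.range X) = ⊤ := by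
    rw [← top_le_iff]
    intro r _
    have hr : r ∈ Algebra.adjoin A (Set.range x) := hxtop ▸ Algebra.mem_top
    rw [Algebra.adjoin_range_eq_range_aeval] at hr
    obtain ⟨f, rfl⟩ := hr
    show MvPolynomial.aeval x f ∈ _
    rw [MvPolynomial.aeval_def, MvPolynomial.eval₂_eq']
    refine sum_mem fun a _ => ?_
    rw [← Algebra.smul_def]
    exact Submodule.smul_mem _ _ (Submodule.subset_span ⟨a, rfl⟩)
  let m : I → M := fun i => X (mo.toSyn.symm (ofLex i).2) • y (ofLex i).1
  let d : I → ℤ := fun i => (∑ l, (mo.toSyn.symm (ofLex i).2) l • dx l) + dy (ofLex i).1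
  have hd : ∀ i, m i ∈ 𝓜 (d i) := fun i =>
    SetLike.GradedSMul.smul_mem (hXd _) (hy _)
  have hm : Submodule.span A (Set.range m) = ⊤ := by
    rw [← top_le_iff]
    intro z _
    have hz : z ∈ Submodule.span R (Set.range y) := hytop ▸ Submodule.mem_top
    rw [← Submodule.restrictScalars_mem A, ← Submodule.span_smul_of_span_eq_top hXspan] at hz
    refine Submodule.span_mono ?_ hz
    rintro _ ⟨_, ⟨a, rfl⟩, _, ⟨j, rfl⟩, rfl⟩
    exact ⟨toLex (j, mo.toSyn a), by simp [m]⟩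
  have hfinite : (Set.range fun p : PrimeSpectrum A => HilbStrata.Red m p.asIdeal).Finite := by
    apply HilbStrata.finite_values
    intro p
    obtain ⟨f, hf, h⟩ := HilbStrata.generic (T := Fin n →₀ ℕ) m hm
      (fun t i => toLex ((ofLex i).1, mo.toSyn t + (ofLex i).2))
      (by
        intro t i j hij
        rw [Prod.Lex.lt_iff] at hij ⊢
        rcases hij with h | ⟨h1, h2⟩
        · exact Or.inl h
        · exact Or.inr ⟨h1, by simpa using h2⟩)
      (fun t => Algebra.lsmul A A M (X t))
      (by
        intro t i
        simp [m, hX, mul_smul])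
      (by
        intro D
        let φ : Fin k × (Fin n →₀ ℕ) → I := fun i => toLex (i.1, mo.toSyn i.2)
        obtain ⟨G, hG, h⟩ := HilbStrata.dickson (φ ⁻¹' D)
        refine ⟨G.image φ, ?_, ?_⟩
        · intro g hg
          obtain ⟨g, hg', rfl⟩ := Finset.mem_image.mp (Finset.mem_coe.mp hg)
          exact hG hg'
        · intro i hi
          obtain ⟨g, hg, t, ht⟩ := h ((ofLex i).1, mo.toSyn.symm (ofLex i).2)
            (by simpa [φ] using hi)
          refine ⟨φ g, Finset.mem_image_of_mem _ hg, t, ?_⟩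
          have := congrArg φ ht
          simpa [φ] using this)
      p.asIdeal
    exact ⟨f, hf, fun q hpq hfq => h q.asIdeal hpq hfq⟩
  refine (hfinite.image fun S : Set I => fun ν : ℤ => Nat.card {i // i ∉ S ∧ d i = ν}).subset ?_
  rintro _ ⟨p, rfl⟩
  refine ⟨_, ⟨p, rfl⟩, ?_⟩
  funext ν
  exact (HilbStrata.finrank_eq m hm 𝓜 d hd p.asIdeal ν).symm
end
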